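/- arXiv:2012.01670 — 2 statements merged into one kernel-verified Lean document; each statement's English description precedes it below -/
import Mathlib

section
/- Let τ have positive imaginary part, q = exp(2πiτ), and θ₁ the first Jacobi theta function. For any positive integer n and complex numbers y, z such that all terms are defined (i.e., y, nz, and z - kπ/n for k = 0,...,n-1 are not in the zero lattice of the respective theta functions), we have n·θ₁'(0|nτ)·θ₁(nz+y|nτ)·θ₁(y|τ) / (θ₁'(0|τ)·θ₁(nz|nτ)·θ₁(y|nτ)) = ∑_{k=0}^{n-1} θ₁(z + y - kπ/n|τ)/θ₁(z - kπ/n|τ). -/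
open Complex

/-- The first Jacobi theta function
`θ₁(z|τ) = 2 ∑_{n≥0} (-1)^n q^{(2n+1)²/8} sin((2n+1)z)` with `q = exp(2πiτ)`,
so that `q^{(2n+1)²/8} = exp(π i τ (2n+1)²/4)`. -/
noncomputable def theta1 (z τ : ℂ) : ℂ :=
  2 * ∑' n : ℕ, (-1 : ℂ) ^ n *
    Complex.exp (Real.pi * Complex.I * τ * (2 * n + 1) ^ 2 / 4) *
    Complex.sin ((2 * n + 1) * z)

/-- The `z`-derivative of the first Jacobi theta function. -/
noncomputable def theta1' (z τ : ℂ) : ℂ := deriv (fun w => theta1 w τ) z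

/-- The integral of an entire `1`-periodic function over a horizontal period does not depend on
the period chosen. -/
lemma integral_add_const_of_periodic {G : ℂ → ℂ} (hG : Differentiable ℂ G)
    (hper : ∀ w, G (w + 1) = G w) (c : ℂ) :
    ∫ t : ℝ in (0 : ℝ)..1, G (t + c) = ∫ t : ℝ in (0 : ℝ)..1, G t := by
  have hrect := integral_boundary_rect_eq_zero_of_differentiableOn G 0 (1 + c.im * I)
    hG.differentiableOn
  have hside : ∀ y : ℝ, G (1 + y * I) = G (y * I) := fun y => by
    rw [add_comm, hper]
  have hshift : Function.Periodic (fun t : ℝ => G (t + c.im * I)) 1 := fun t => by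
    simp only [ofReal_add, ofReal_one]
    rw [add_right_comm, hper]
  have hre : ∫ t : ℝ in (0 : ℝ)..1, G (t + c) = ∫ t : ℝ in (0 : ℝ)..1, G (t + c.im * I) := by
    have h := hshift.intervalIntegral_add_eq c.re 0
    rw [zero_add, add_comm c.re 1] at h
    have h' := intervalIntegral.integral_comp_add_right (a := 0) (b := 1)
      (fun t : ℝ => G (t + c.im * I)) c.re
    simp only [zero_add, ofReal_add, add_assoc, re_add_im] at h'
    rw [← h, h']
  rw [hre]
  simp [hside] at hrect
  exact (sub_eq_zero.mp hrect).symm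

/-- Entire functions with the quasi-periodicity of `jacobiTheta₂ · τ` are its multiples. -/
lemma exists_eq_const_mul_jacobiTheta₂ {τ : ℂ} (hτ : 0 < τ.im) {F : ℂ → ℂ}
    (hF : Differentiable ℂ F) (hper : ∀ w, F (w + 1) = F w)
    (hqper : ∀ w, F (w + τ) = exp (-Real.pi * I * (τ + 2 * w)) * F w) :
    ∃ c : ℂ, ∀ w, F w = c * jacobiTheta₂ w τ := by
  set a : ℤ → ℂ := fun m => ∫ t : ℝ in (0 : ℝ)..1, exp (-(2 * Real.pi * I * m * t)) * F t with ha
  have hstep : ∀ m : ℤ, a (m + 1) = exp (Real.pi * I * (2 * m + 1) * τ) * a m := fun m => by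
    have h := integral_add_const_of_periodic
      (G := fun w => exp (-(2 * Real.pi * I * m * w)) * F w) (by fun_prop)
      (fun w => by
        have : exp (-(2 * Real.pi * I * m * (w + 1))) = exp (-(2 * Real.pi * I * m * w)) := by
          rw [exp_eq_exp_iff_exists_int]
          exact ⟨-m, by push_cast; ring⟩
        rw [hper, this]) τ
    simp only [ha]
    rw [← h, ← intervalIntegral.integral_const_mul]
    refine intervalIntegral.integral_congr fun t _ => ?_
    rw [hqper, ← mul_assoc, ← mul_assoc, ← exp_add, ← exp_add]
    congr 2
    push_cast
    ring
  have hcoeff : ∀ m : ℤ, a m = exp (Real.pi * I * m ^ 2 * τ) * a 0 := fun m => by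
    induction m with
    | zero => simp
    | succ k ih =>
      rw [hstep, ih, ← mul_assoc, ← exp_add]
      push_cast
      ring_nf
    | pred k ih =>
      have h := hstep (-k - 1)
      rw [sub_add_cancel, ih] at h
      have h' : a (-k - 1) = exp (-(Real.pi * I * (2 * ((-k - 1 : ℤ) : ℂ) + 1) * τ)) *
          (exp (Real.pi * I * ((-k : ℤ) : ℂ) ^ 2 * τ) * a 0) := by
        rw [h, ← mul_assoc, ← exp_add, neg_add_cancel, exp_zero, one_mul]
      rw [h', ← mul_assoc, ← exp_add]
      push_cast
      ring_nf
  have hFper : Function.Periodic (fun t : ℝ => F t) 1 := fun t => by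
    simp only [ofReal_add, ofReal_one, hper]
  let f : C(UnitAddCircle, ℂ) := ⟨hFper.lift, by
    refine continuous_coinduced_dom.mpr ?_
    exact hF.continuous.comp continuous_ofReal⟩
  have hf : ∀ t : ℝ, f (t : UnitAddCircle) = F t := fun t => hFper.lift_coe t
  have hfc : ∀ m, fourierCoeff f m = a m := fun m => by
    rw [fourierCoeff_eq_intervalIntegral _ m 0]
    simp only [fourier_coe_apply, hf, ha]
    simp
  have hterm : ∀ (m : ℤ) (t : ℝ), fourierCoeff f m • fourier m (t : UnitAddCircle) =
      a 0 * jacobiTheta₂_term m t τ := fun m t => by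
    rw [hfc, hcoeff, fourier_coe_apply, jacobiTheta₂_term, exp_add]
    simp
    ring
  have hsum : Summable (fourierCoeff f) := by
    refine (((summable_jacobiTheta₂_term_iff 0 τ).mpr hτ).mul_left (a 0)).congr fun m => ?_
    rw [hfc, hcoeff m, jacobiTheta₂_term]
    simp
    ring
  have hreal : ∀ t : ℝ, F t = a 0 * jacobiTheta₂ t τ := fun t => by
    have h := has_pointwise_sum_fourier_series_of_summable hsum (t : UnitAddCircle)
    simp only [hterm, hf] at h
    exact h.unique ((hasSum_jacobiTheta₂_term t hτ).mul_left _)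
  have hJ : Differentiable ℂ fun w => a 0 * jacobiTheta₂ w τ := fun w =>
    (differentiableAt_jacobiTheta₂_fst w hτ).const_mul _
  refine ⟨a 0, congrFun (AnalyticOnNhd.eq_of_frequently_eq (z₀ := 0)
    (fun w _ => hF.analyticAt w) (fun w _ => hJ.analyticAt w) ?_)⟩
  have htend : Filter.Tendsto (fun t : ℝ => (t : ℂ)) (nhdsWithin 0 {0}ᶜ) (nhdsWithin 0 {0}ᶜ) := by
    refine tendsto_nhdsWithin_of_tendsto_nhds_of_eventually_within _ ?_ ?_
    · exact (continuous_ofReal.tendsto' 0 0 (by simp)).mono_left nhdsWithin_le_nhds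
    · filter_upwards [self_mem_nhdsWithin] with t ht
      simpa using ht
  exact htend.frequently (Filter.Eventually.of_forall hreal).frequently

/-- The first Jacobi theta function in terms of `jacobiTheta₂`. -/
lemma theta1_eq_jacobiTheta₂ {τ : ℂ} (hτ : 0 < τ.im) (z : ℂ) :
    theta1 z τ = -I * exp (I * z + Real.pi * I * τ / 4) *
      jacobiTheta₂ (z / Real.pi + τ / 2 + 1 / 2) τ := by
  have hpi : (Real.pi : ℂ) ≠ 0 := by exact_mod_cast Real.pi_ne_zero
  have h := ((hasSum_jacobiTheta₂_term (z / Real.pi + τ / 2 + 1 / 2) hτ).mul_left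
    (-I * exp (I * z + Real.pi * I * τ / 4))).nat_add_neg_add_one
  rw [← h.tsum_eq, theta1, ← tsum_mul_left]
  refine tsum_congr fun m => ?_
  have hterm : ∀ k : ℤ, -I * exp (I * z + Real.pi * I * τ / 4) *
      jacobiTheta₂_term k (z / Real.pi + τ / 2 + 1 / 2) τ =
      -I * ((-1) ^ k * exp (Real.pi * I * τ * (2 * k + 1) ^ 2 / 4) *
        exp ((2 * k + 1) * z * I)) := fun k => by
    rw [jacobiTheta₂_term, mul_assoc, ← exp_add, ← exp_pi_mul_I, ← exp_int_mul, ← exp_add,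
      ← exp_add]
    congr 2
    field_simp
    ring
  have hsign : (-1 : ℂ) ^ (-((m : ℤ) + 1)) = -(-1) ^ m := by
    rw [zpow_neg, ← inv_zpow, show ((-1 : ℂ)⁻¹) = -1 by norm_num, zpow_add₀ (by norm_num)]
    simp
  rw [hterm, hterm, hsign, sin, zpow_natCast]
  push_cast
  rw [show (2 * -((m : ℂ) + 1) + 1) = -(2 * m + 1) by ring, neg_sq,
    show -((2 * (m : ℂ) + 1) * z) * I = -(2 * m + 1) * z * I by ring]
  ring

lemma differentiable_theta1 {τ : ℂ} (hτ : 0 < τ.im) : Differentiable ℂ fun z => theta1 z τ := by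
  simp only [theta1_eq_jacobiTheta₂ hτ]
  have hJ : Differentiable ℂ fun w => jacobiTheta₂ w τ := fun w =>
    differentiableAt_jacobiTheta₂_fst w hτ
  have := hJ.comp (f := fun z => z / Real.pi + τ / 2 + 1 / 2) (by fun_prop)
  exact Differentiable.mul (by fun_prop) this

lemma theta1_zero (τ : ℂ) : theta1 0 τ = 0 := by
  simp [theta1]

lemma theta1_add_pi {τ : ℂ} (hτ : 0 < τ.im) (z : ℂ) :
    theta1 (z + Real.pi) τ = -theta1 z τ := by
  have hpi : (Real.pi : ℂ) ≠ 0 := by exact_mod_cast Real.pi_ne_zero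
  rw [theta1_eq_jacobiTheta₂ hτ, theta1_eq_jacobiTheta₂ hτ,
    show (z + Real.pi) / Real.pi + τ / 2 + 1 / 2 = z / Real.pi + τ / 2 + 1 / 2 + 1 by
      field_simp; ring, jacobiTheta₂_add_left,
    show I * (z + Real.pi) + Real.pi * I * τ / 4 =
      I * z + Real.pi * I * τ / 4 + Real.pi * I by ring, exp_add_pi_mul_I]
  ring

lemma theta1_add_pi_mul {τ : ℂ} (hτ : 0 < τ.im) (z : ℂ) :
    theta1 (z + Real.pi * τ) τ = -exp (-(Real.pi * I * τ) - 2 * I * z) * theta1 z τ := by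
  have hpi : (Real.pi : ℂ) ≠ 0 := by exact_mod_cast Real.pi_ne_zero
  rw [theta1_eq_jacobiTheta₂ hτ, theta1_eq_jacobiTheta₂ hτ,
    show (z + Real.pi * τ) / Real.pi + τ / 2 + 1 / 2 = z / Real.pi + τ / 2 + 1 / 2 + τ by
      field_simp; ring, jacobiTheta₂_add_left', ← exp_add_pi_mul_I]
  have hexp : exp (I * (z + Real.pi * τ) + Real.pi * I * τ / 4) *
      exp (-Real.pi * I * (τ + 2 * (z / Real.pi + τ / 2 + 1 / 2))) =
      exp (-(Real.pi * I * τ) - 2 * I * z + Real.pi * I) *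
        exp (I * z + Real.pi * I * τ / 4) := by
    rw [← exp_add, ← exp_add, exp_eq_exp_iff_exists_int]
    refine ⟨-1, ?_⟩
    field_simp
    push_cast
    ring
  linear_combination (-I * jacobiTheta₂ (z / Real.pi + τ / 2 + 1 / 2) τ) * hexp

/-- Entire functions with the quasi-periodicity of `theta1 · τ` are its multiples. -/
lemma exists_eq_const_mul_theta1 {τ : ℂ} (hτ : 0 < τ.im) {f : ℂ → ℂ} (hf : Differentiable ℂ f)
    (hper : ∀ z, f (z + Real.pi) = -f z)
    (hqper : ∀ z, f (z + Real.pi * τ) = -exp (-(Real.pi * I * τ) - 2 * I * z) * f z) :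
    ∃ c : ℂ, ∀ z, f z = c * theta1 z τ := by
  have hpi : (Real.pi : ℂ) ≠ 0 := by exact_mod_cast Real.pi_ne_zero
  obtain ⟨c, hc⟩ := exists_eq_const_mul_jacobiTheta₂ hτ
    (F := fun w => exp (-(Real.pi * I * w)) * f (Real.pi * (w - τ / 2 - 1 / 2)))
    (Differentiable.mul (by fun_prop) (hf.comp (by fun_prop)))
    (fun w => by
      rw [show Real.pi * (w + 1 - τ / 2 - 1 / 2) =
        Real.pi * (w - τ / 2 - 1 / 2) + Real.pi by ring, hper,
        show -(Real.pi * I * (w + 1)) = -(Real.pi * I * w) - Real.pi * I by ring,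
        exp_sub_pi_mul_I]
      ring)
    (fun w => by
      rw [show Real.pi * (w + τ - τ / 2 - 1 / 2) =
        Real.pi * (w - τ / 2 - 1 / 2) + Real.pi * τ by ring, hqper, ← exp_sub_pi_mul_I,
        ← mul_assoc, ← mul_assoc (exp (-Real.pi * I * (τ + 2 * w))), ← exp_add, ← exp_add]
      congr 2
      ring)
  refine ⟨-c * exp (Real.pi * I * τ / 4), fun z => ?_⟩
  have h := hc (z / Real.pi + τ / 2 + 1 / 2)
  rw [show Real.pi * (z / Real.pi + τ / 2 + 1 / 2 - τ / 2 - 1 / 2) = z by field_simp; ring] at h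
  have hexp : exp (I * z + Real.pi * I * τ / 4) * exp (Real.pi * I * τ / 4) * I *
      exp (-(Real.pi * I * (z / Real.pi + τ / 2 + 1 / 2))) = 1 := by
    rw [mul_right_comm, ← exp_add, ← exp_add]
    have : I * z + Real.pi * I * τ / 4 + Real.pi * I * τ / 4 +
      -(Real.pi * I * (z / Real.pi + τ / 2 + 1 / 2)) = -(Real.pi / 2 * I) := by
      field_simp
      ring
    rw [this, exp_neg, exp_pi_div_two_mul_I, inv_mul_cancel₀ I_ne_zero]
  rw [theta1_eq_jacobiTheta₂ hτ]
  linear_combination (-f z) * hexp + exp (I * z + Real.pi * I * τ / 4) *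
    exp (Real.pi * I * τ / 4) * I * h

/-- The product `∏ (1 - qᵏ u)` over `k ≥ 0`. -/
noncomputable def qProd (q u : ℂ) : ℂ := ∏' k : ℕ, (1 + -(q ^ k * u))

lemma summable_norm_pow_mul {q : ℂ} (hq : ‖q‖ < 1) (u : ℂ) :
    Summable fun k : ℕ => ‖-(q ^ k * u)‖ := by
  simpa using (summable_geometric_of_lt_one (norm_nonneg _) hq).mul_right ‖u‖

lemma qProd_eq_one_sub_mul {q : ℂ} (hq : ‖q‖ < 1) (u : ℂ) :
    qProd q u = (1 - u) * qProd q (q * u) := by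
  have hmul : Multipliable fun k : ℕ => 1 + -(q ^ k * (q * u)) :=
    multipliable_one_add_of_summable (summable_norm_pow_mul hq (q * u))
  have hshift : (fun k : ℕ => 1 + -(q ^ k * (q * u))) = fun k => 1 + -(q ^ (k + 1) * u) :=
    funext fun k => by rw [pow_succ, mul_assoc]
  rw [qProd, qProd, hshift, tprod_eq_zero_mul' (f := fun k => 1 + -(q ^ k * u)) (hshift ▸ hmul),
    pow_zero, one_mul, sub_eq_add_neg]

lemma qProd_ne_zero {q : ℂ} (hq : ‖q‖ < 1) : qProd q q ≠ 0 := by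
  refine tprod_one_add_ne_zero_of_summable (fun k h => ?_) (summable_norm_pow_mul hq q)
  have hk : q ^ (k + 1) = 1 := by rw [pow_succ]; linear_combination -h
  have := congrArg norm hk
  rw [norm_pow, norm_one] at this
  exact (pow_lt_one₀ (norm_nonneg q) hq k.succ_ne_zero).ne this

lemma differentiable_qProd {q : ℂ} (hq : ‖q‖ < 1) : Differentiable ℂ (qProd q) := by
  intro u
  have hball : IsOpen (Metric.ball (0 : ℂ) (‖u‖ + 1)) := Metric.isOpen_ball
  have hprod := Summable.hasProdLocallyUniformlyOn_nat_one_add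
    (f := fun k u => -(q ^ k * u)) hball
    ((summable_geometric_of_lt_one (norm_nonneg _) hq).mul_right (‖u‖ + 1))
    (.of_forall fun k x hx => by
      rw [mem_ball_zero_iff] at hx
      rw [norm_neg, norm_mul, norm_pow]
      gcongr)
    (fun k => by fun_prop)
  have hdiff := hprod.differentiableOn (.of_forall fun s => by
    simpa [Finset.prod_fn] using DifferentiableOn.finsetProd (fun _ _ => by fun_prop)) hball
  exact hdiff.differentiableAt (hball.mem_nhds (by simp))

/-- The zero of `theta1 · τ` at the origin is simple. -/
lemma theta1'_zero_ne_zero {τ : ℂ} (hτ : 0 < τ.im) : theta1' 0 τ ≠ 0 := by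
  set q := exp (2 * Real.pi * I * τ) with hq_def
  have hq : ‖q‖ < 1 := by
    rw [hq_def, norm_exp, Real.exp_lt_one_iff]
    simp
    positivity
  set g : ℂ → ℂ := fun z => qProd q (q * exp (2 * I * z)) * qProd q (q * exp (-(2 * I * z)))
    with hg_def
  have hg : Differentiable ℂ g := by
    have h := differentiable_qProd hq
    exact (h.comp (f := fun z => q * exp (2 * I * z)) (by fun_prop)).mul
      (h.comp (f := fun z => q * exp (-(2 * I * z))) (by fun_prop))
  obtain ⟨c, hc⟩ := exists_eq_const_mul_theta1 hτ (f := fun z => sin z * g z)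
    (differentiable_sin.mul hg)
    (fun z => by
      have h₁ : exp (2 * I * (z + Real.pi)) = exp (2 * I * z) := by
        rw [exp_eq_exp_iff_exists_int]
        exact ⟨1, by push_cast; ring⟩
      have h₂ : exp (-(2 * I * (z + Real.pi))) = exp (-(2 * I * z)) := by
        rw [exp_neg, h₁, exp_neg]
      simp only [hg_def, h₁, h₂, sin_add_pi, neg_mul])
    (fun z => by
      have h₁ : exp (2 * I * (z + Real.pi * τ)) = q * exp (2 * I * z) := by
        rw [hq_def, ← exp_add]
        ring_nf
      have h₂ : q * exp (-(2 * I * (z + Real.pi * τ))) = exp (-(2 * I * z)) := by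
        rw [hq_def, ← exp_add]
        ring_nf
      have h₃ := qProd_eq_one_sub_mul hq (q * exp (2 * I * z))
      have h₄ := qProd_eq_one_sub_mul hq (exp (-(2 * I * z)))
      simp only [hg_def]
      rw [h₁, h₂, h₃, h₄]
      have hsin : sin (z + Real.pi * τ) * (1 - exp (-(2 * I * z))) =
          -exp (-(Real.pi * I * τ) - 2 * I * z) * sin z * (1 - q * exp (2 * I * z)) := by
        set v := exp (z * I) with hv
        set r := exp (Real.pi * τ * I) with hr
        have hv0 : v ≠ 0 := exp_ne_zero _
        have hr0 : r ≠ 0 := exp_ne_zero _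
        have e₁ : exp ((z + Real.pi * τ) * I) = v * r := by
          rw [hv, hr, ← exp_add]; ring_nf
        have e₂ : exp (2 * I * z) = v ^ 2 := by
          rw [hv, ← exp_nat_mul]; push_cast; ring_nf
        have e₃ : q = r ^ 2 := by
          rw [hq_def, hr, ← exp_nat_mul]; push_cast; ring_nf
        have e₄ : exp (-(Real.pi * I * τ) - 2 * I * z) = r⁻¹ * (v ^ 2)⁻¹ := by
          rw [← e₂, hr, ← exp_neg, ← exp_neg, ← exp_add]; ring_nf
        rw [sin, sin, neg_mul, neg_mul z, exp_neg, exp_neg, exp_neg, e₁, e₂, e₃, e₄, ← hv]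
        field_simp
        ring
      linear_combination (qProd q (q * (q * exp (2 * I * z))) *
        qProd q (q * exp (-(2 * I * z)))) * hsin)
  have h₁ : HasDerivAt (fun z => sin z * g z) (g 0) 0 := by
    simpa using (hasDerivAt_sin 0).fun_mul (hg 0).hasDerivAt
  have h₂ : HasDerivAt (fun z => sin z * g z) (c * theta1' 0 τ) 0 := by
    simp only [hc]
    exact ((differentiable_theta1 hτ 0).hasDerivAt).const_mul c
  have hg0 : g 0 ≠ 0 := by
    simpa [hg_def] using qProd_ne_zero hq
  rw [h₁.unique h₂] at hg0
  exact right_ne_zero_of_mul hg0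

/-- Translating a `p`-antiperiodic function by the multiples of `p / n` and multiplying gives a
`p / n`-antiperiodic function. -/
lemma prod_translates_add {c : ℂ → ℂ} {p : ℂ} (hc : ∀ z, c (z + p) = -c z) {n : ℕ} (hn : 0 < n)
    (z : ℂ) : ∏ k ∈ Finset.range n, c (z + p / n - k * p / n) =
      -∏ k ∈ Finset.range n, c (z - k * p / n) := by
  obtain ⟨m, rfl⟩ := Nat.exists_eq_succ_of_ne_zero hn.ne'
  have hm : ((m : ℂ) + 1) ≠ 0 := Nat.cast_add_one_ne_zero m
  rw [Finset.prod_range_succ', Finset.prod_range_succ, ← mul_neg, ← hc]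
  congr 1
  · refine Finset.prod_congr rfl fun k _ => ?_
    congr 1
    push_cast
    field_simp
    ring
  · congr 1
    push_cast
    field_simp
    ring

/-- The product of the quasi-periodicity factors of the translates `theta1 (z - kπ/n) τ`. -/
lemma prod_quasiperiod_factors (τ z : ℂ) {n : ℕ} (hn : 0 < n) :
    ∏ k ∈ Finset.range n, -exp (-(Real.pi * I * τ) - 2 * I * (z - k * Real.pi / n)) =
      -exp (-(Real.pi * I * (n * τ)) - 2 * I * (n * z)) := by
  have hn0 : (n : ℂ) ≠ 0 := by exact_mod_cast hn.ne'
  have hgauss : ∑ k ∈ Finset.range n, (k : ℂ) = n * (n - 1) / 2 := by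
    have h := congrArg (Nat.cast : ℕ → ℂ) (Finset.sum_range_id_mul_two n)
    rw [Nat.cast_mul, Nat.cast_mul, Nat.cast_pred hn, Nat.cast_sum] at h
    push_cast at h
    linear_combination h / 2
  simp only [← exp_add_pi_mul_I]
  rw [← exp_sum, exp_eq_exp_iff_exists_int]
  refine ⟨n - 1, ?_⟩
  have hterm : ∀ k : ℕ, -(Real.pi * I * τ) - 2 * I * (z - k * Real.pi / n) + Real.pi * I =
      (-(Real.pi * I * τ) - 2 * I * z + Real.pi * I) + 2 * I * Real.pi / n * k := fun k => by
    ring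
  simp only [hterm]
  rw [Finset.sum_add_distrib, ← Finset.mul_sum, hgauss]
  simp
  field_simp
  ring

/-- The numerator of `∑ k, theta1 (z + y - kπ/n) τ / theta1 (z - kπ/n) τ` over the common
denominator `∏ k, theta1 (z - kπ/n) τ`. -/
noncomputable def thetaNumerator (n : ℕ) (y τ z : ℂ) : ℂ :=
  ∑ k ∈ Finset.range n, (∏ j ∈ (Finset.range n).erase k, theta1 (z - j * Real.pi / n) τ) *
    theta1 (z + y - k * Real.pi / n) τ

lemma hasDerivAt_prod_translates (n : ℕ) (y τ z : ℂ) :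
    HasDerivAt (fun t : ℂ => ∏ k ∈ Finset.range n,
      (theta1 (z - k * Real.pi / n) τ + t * theta1 (z - k * Real.pi / n + y) τ))
      (thetaNumerator n y τ z) 0 := by
  have h := HasDerivAt.fun_finsetProd (u := Finset.range n) (x := (0 : ℂ))
    (f := fun k t => theta1 (z - k * Real.pi / n) τ + t * theta1 (z - k * Real.pi / n + y) τ)
    (f' := fun k => theta1 (z - k * Real.pi / n + y) τ) (fun k _ => by
      simpa using ((hasDerivAt_id (0 : ℂ)).mul_const
        (theta1 (z - k * Real.pi / n + y) τ)).const_add (theta1 (z - k * Real.pi / n) τ))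
  have hval : thetaNumerator n y τ z = _ := Finset.sum_congr rfl fun k _ => by
    rw [add_sub_right_comm]
  rw [hval]
  simpa using h

lemma thetaNumerator_add_pi_div {τ : ℂ} (hτ : 0 < τ.im) {n : ℕ} (hn : 0 < n) (y z : ℂ) :
    thetaNumerator n y τ (z + Real.pi / n) = -thetaNumerator n y τ z := by
  refine (hasDerivAt_prod_translates n y τ (z + Real.pi / n)).unique ?_
  refine (hasDerivAt_prod_translates n y τ z).fun_neg.congr_of_eventuallyEq
    (.of_forall fun t => ?_)
  refine prod_translates_add (c := fun w => theta1 w τ + t * theta1 (w + y) τ) (fun w => ?_) hn z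
  rw [add_right_comm, theta1_add_pi hτ, theta1_add_pi hτ]
  ring

lemma thetaNumerator_add_pi_mul {τ : ℂ} (hτ : 0 < τ.im) {n : ℕ} (hn : 0 < n) (y z : ℂ) :
    thetaNumerator n y τ (z + Real.pi * τ) =
      -exp (-(Real.pi * I * (n * τ)) - 2 * I * (n * z + y)) * thetaNumerator n y τ z := by
  have hfactor : -exp (-(Real.pi * I * (n * τ)) - 2 * I * (n * z + y)) =
      -exp (-(Real.pi * I * (n * τ)) - 2 * I * (n * z)) * exp (-(2 * I * y)) := by
    rw [neg_mul, ← exp_add]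
    ring_nf
  rw [hfactor, ← prod_quasiperiod_factors τ z hn, thetaNumerator, thetaNumerator, Finset.mul_sum]
  refine Finset.sum_congr rfl fun k hk => ?_
  rw [← Finset.prod_erase_mul _ _ hk]
  have hprod : ∏ j ∈ (Finset.range n).erase k, theta1 (z + Real.pi * τ - j * Real.pi / n) τ =
      (∏ j ∈ (Finset.range n).erase k,
        -exp (-(Real.pi * I * τ) - 2 * I * (z - j * Real.pi / n))) *
      ∏ j ∈ (Finset.range n).erase k, theta1 (z - j * Real.pi / n) τ := by
    rw [← Finset.prod_mul_distrib]
    refine Finset.prod_congr rfl fun j _ => ?_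
    rw [add_sub_right_comm, theta1_add_pi_mul hτ]
  have hexp : exp (-(Real.pi * I * τ) - 2 * I * (z + y - k * Real.pi / n)) =
      exp (-(Real.pi * I * τ) - 2 * I * (z - k * Real.pi / n)) * exp (-(2 * I * y)) := by
    rw [← exp_add]
    ring_nf
  rw [hprod, show z + Real.pi * τ + y - k * Real.pi / n =
    z + y - k * Real.pi / n + Real.pi * τ by ring, theta1_add_pi_mul hτ, hexp]
  ring

lemma differentiable_prod_theta1 {τ : ℂ} (hτ : 0 < τ.im) (n : ℕ) (s : Finset ℕ) :
    Differentiable ℂ fun z => ∏ k ∈ s, theta1 (z - k * Real.pi / n) τ :=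
  Differentiable.fun_finsetProd fun k _ => (differentiable_theta1 hτ).comp
    (f := fun z : ℂ => z - k * Real.pi / n) (by fun_prop)

lemma differentiable_thetaNumerator {τ : ℂ} (hτ : 0 < τ.im) (n : ℕ) (y : ℂ) :
    Differentiable ℂ (thetaNumerator n y τ) := by
  unfold thetaNumerator
  exact Differentiable.fun_sum fun k _ => (differentiable_prod_theta1 hτ n _).mul
    ((differentiable_theta1 hτ).comp (f := fun z : ℂ => z + y - k * Real.pi / n) (by fun_prop))

lemma im_natCast_mul_pos {τ : ℂ} (hτ : 0 < τ.im) {n : ℕ} (hn : 0 < n) :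
    0 < ((n : ℂ) * τ).im := by
  simp
  positivity

lemma exists_thetaNumerator_eq {τ : ℂ} (hτ : 0 < τ.im) {n : ℕ} (hn : 0 < n) (y : ℂ) :
    ∃ c : ℂ, ∀ z, thetaNumerator n y τ z = c * theta1 (n * z + y) (n * τ) := by
  have hn0 : (n : ℂ) ≠ 0 := by exact_mod_cast hn.ne'
  obtain ⟨c, hc⟩ := exists_eq_const_mul_theta1 (im_natCast_mul_pos hτ hn)
    (f := fun w => thetaNumerator n y τ ((w - y) / n))
    ((differentiable_thetaNumerator hτ n y).comp (by fun_prop))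
    (fun w => by
      rw [← thetaNumerator_add_pi_div hτ hn]
      congr 1
      ring)
    (fun w => by
      rw [show (w + Real.pi * (n * τ) - y) / n = (w - y) / n + Real.pi * τ by
        field_simp; ring, thetaNumerator_add_pi_mul hτ hn, mul_div_cancel₀ _ hn0,
        sub_add_cancel])
  refine ⟨c, fun z => ?_⟩
  rw [← hc, add_sub_cancel_right, mul_div_cancel_left₀ _ hn0]

lemma exists_prod_theta1_eq {τ : ℂ} (hτ : 0 < τ.im) {n : ℕ} (hn : 0 < n) :
    ∃ c : ℂ, ∀ z, ∏ k ∈ Finset.range n, theta1 (z - k * Real.pi / n) τ =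
      c * theta1 (n * z) (n * τ) := by
  have hn0 : (n : ℂ) ≠ 0 := by exact_mod_cast hn.ne'
  obtain ⟨c, hc⟩ := exists_eq_const_mul_theta1 (im_natCast_mul_pos hτ hn)
    (f := fun w => ∏ k ∈ Finset.range n, theta1 (w / n - k * Real.pi / n) τ)
    ((differentiable_prod_theta1 hτ n _).comp (f := fun w : ℂ => w / n) (by fun_prop))
    (fun w => by
      simp only [add_div]
      exact prod_translates_add (c := fun w => theta1 w τ) (theta1_add_pi hτ) hn _)
    (fun w => by
      have h := prod_quasiperiod_factors τ (w / n) hn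
      rw [mul_div_cancel₀ _ hn0] at h
      rw [← h, ← Finset.prod_mul_distrib]
      refine Finset.prod_congr rfl fun k _ => ?_
      rw [← theta1_add_pi_mul hτ]
      congr 1
      field_simp
      ring)
  refine ⟨c, fun z => ?_⟩
  rw [← hc, mul_div_cancel_left₀ _ hn0]

lemma thetaNumerator_zero {n : ℕ} (hn : 0 < n) (y τ : ℂ) :
    thetaNumerator n y τ 0 =
      (∏ j ∈ (Finset.range n).erase 0, theta1 (0 - j * Real.pi / n) τ) * theta1 y τ := by
  have h0 : 0 ∈ Finset.range n := Finset.mem_range.mpr hn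
  rw [thetaNumerator, Finset.sum_eq_single_of_mem 0 h0]
  · simp
  · intro k _ hk
    rw [Finset.prod_eq_zero (Finset.mem_erase.mpr ⟨hk.symm, h0⟩) (by simp [theta1_zero]), zero_mul]

lemma hasDerivAt_prod_theta1_zero {τ : ℂ} (hτ : 0 < τ.im) {n : ℕ} (hn : 0 < n) :
    HasDerivAt (fun z => ∏ k ∈ Finset.range n, theta1 (z - k * Real.pi / n) τ)
      ((∏ j ∈ (Finset.range n).erase 0, theta1 (0 - j * Real.pi / n) τ) * theta1' 0 τ) 0 := by
  have h0 : 0 ∈ Finset.range n := Finset.mem_range.mpr hn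
  have hA := differentiable_prod_theta1 hτ n ((Finset.range n).erase 0) 0
  have hθ : HasDerivAt (fun z => theta1 z τ) (theta1' 0 τ) 0 :=
    (differentiable_theta1 hτ 0).hasDerivAt
  have h := hA.hasDerivAt.fun_mul hθ
  rw [theta1_zero, mul_zero, zero_add] at h
  refine h.congr_of_eventuallyEq (.of_forall fun z => ?_)
  simp only
  rw [← Finset.prod_erase_mul _ _ h0]
  simp

theorem theta_multiplication_identity (τ : ℂ) (hτ : 0 < τ.im)
    (n : ℕ) (hn : 0 < n) (y z : ℂ)
    (h1 : theta1 ((n : ℂ) * z) ((n : ℂ) * τ) ≠ 0)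
    (h2 : theta1 y ((n : ℂ) * τ) ≠ 0)
    (h3 : theta1 y τ ≠ 0)
    (h4 : ∀ k < n, theta1 (z - k * Real.pi / n) τ ≠ 0) :
    (n : ℂ) * theta1' 0 ((n : ℂ) * τ) * theta1 ((n : ℂ) * z + y) ((n : ℂ) * τ) *
        theta1 y τ /
      (theta1' 0 τ * theta1 ((n : ℂ) * z) ((n : ℂ) * τ) * theta1 y ((n : ℂ) * τ)) =
      ∑ k ∈ Finset.range n,
        theta1 (z + y - k * Real.pi / n) τ / theta1 (z - k * Real.pi / n) τ := by
  obtain ⟨c, hc⟩ := exists_thetaNumerator_eq hτ hn y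
  obtain ⟨d, hd⟩ := exists_prod_theta1_eq hτ hn
  have hP : ∏ k ∈ Finset.range n, theta1 (z - k * Real.pi / n) τ ≠ 0 :=
    Finset.prod_ne_zero_iff.mpr fun k hk => h4 k (Finset.mem_range.mp hk)
  have hsum : ∑ k ∈ Finset.range n,
      theta1 (z + y - k * Real.pi / n) τ / theta1 (z - k * Real.pi / n) τ =
      thetaNumerator n y τ z / ∏ k ∈ Finset.range n, theta1 (z - k * Real.pi / n) τ := by
    rw [eq_div_iff hP, thetaNumerator, Finset.sum_mul]
    refine Finset.sum_congr rfl fun k hk => ?_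
    have := h4 k (Finset.mem_range.mp hk)
    rw [← Finset.prod_erase_mul _ _ hk]
    field_simp
  have hvalue := hc 0
  rw [thetaNumerator_zero hn, mul_zero, zero_add] at hvalue
  have hderiv : (∏ j ∈ (Finset.range n).erase 0, theta1 (0 - j * Real.pi / n) τ) * theta1' 0 τ =
      d * (n * theta1' 0 (n * τ)) := by
    refine (hasDerivAt_prod_theta1_zero hτ hn).unique ?_
    simp only [hd]
    have hθ : HasDerivAt (fun w => theta1 w (n * τ)) (theta1' 0 (n * τ)) ((n : ℂ) * 0) := by
      rw [mul_zero]
      exact (differentiable_theta1 (im_natCast_mul_pos hτ hn) 0).hasDerivAt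
    have h := (hθ.comp 0 ((hasDerivAt_id (0 : ℂ)).const_mul (n : ℂ))).const_mul d
    simpa [Function.comp_def, mul_comm] using h
  have hd0 : d ≠ 0 := fun h => hP (by rw [hd, h, zero_mul])
  have hθ0 := theta1'_zero_ne_zero hτ
  rw [hsum, hc, hd]
  rw [div_eq_div_iff (mul_ne_zero (mul_ne_zero hθ0 h1) h2) (mul_ne_zero hd0 h1)]
  linear_combination theta1 (n * z + y) (n * τ) * theta1 (n * z) (n * τ) *
    (theta1' 0 τ * hvalue - theta1 y τ * hderiv)
end

section
/- Let τ have positive imaginary part, q = exp(2πiτ), and θ₁ the first Jacobi theta function. Then for all z with sin z ≠ 0 (more precisely, z not a zero of θ₁(·|τ)): 2∑_{n=-∞}^{∞} (-1)^n q^{n(3n+1)/2} cos((6n+1)z) = (∏_{n=1}^{∞}(1-q^n)) · θ₁(2z|τ)/θ₁(z|τ). (The quintuple product identity of Kiepert.) -/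
open Complex

/-- Splitting a bilateral series into its terms of even and of odd index. -/
lemma HasSum.int_even_add_odd {f : ℤ → ℂ} {a b : ℂ} (he : HasSum (fun n ↦ f (2 * n)) a)
    (ho : HasSum (fun n ↦ f (2 * n + 1)) b) : HasSum f (a + b) := by
  have hinj : Function.Injective (fun n : ℤ ↦ 2 * n) := fun x y h ↦ by simpa using h
  have hinj' : Function.Injective (fun n : ℤ ↦ 2 * n + 1) := fun x y h ↦ by simpa using h
  have heven : Set.range (fun n : ℤ ↦ 2 * n) = {n | Even n} :=
    Set.ext fun n ↦ by simp [even_iff_exists_two_mul]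
  have hodd : Set.range (fun n : ℤ ↦ 2 * n + 1) = {n | Odd n} :=
    Set.ext fun n ↦ by simp [Odd]
  exact HasSum.add_isCompl (heven ▸ hodd ▸ Int.isCompl_even_odd)
    (hinj.hasSum_range_iff.mpr he) (hinj'.hasSum_range_iff.mpr ho)

section Pentagonal

open Filter Topology

variable {x : ℂ}

lemma norm_prod_one_sub_pow_le (hx : ‖x‖ < 1) (k n : ℕ) :
    ‖∏ i ∈ Finset.range n, (1 - x ^ (k + i + 1))‖ ≤ Real.exp (1 - ‖x‖)⁻¹ := by
  calc ‖∏ i ∈ Finset.range n, (1 - x ^ (k + i + 1))‖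
      ≤ ∏ i ∈ Finset.range n, (1 + ‖x‖ ^ i) := by
        rw [norm_prod]
        refine Finset.prod_le_prod (fun _ _ ↦ norm_nonneg _) fun i _ ↦ ?_
        refine (norm_sub_le _ _).trans ?_
        rw [norm_one, norm_pow]
        gcongr 1 + ?_
        exact pow_le_pow_of_le_one (norm_nonneg _) hx.le (by omega)
    _ ≤ Real.exp (∑ i ∈ Finset.range n, ‖x‖ ^ i) :=
        Real.prod_one_add_le_exp_sum _ fun _ ↦ by positivity
    _ ≤ Real.exp (1 - ‖x‖)⁻¹ := by
        gcongr
        rw [← tsum_geometric_of_lt_one (norm_nonneg _) hx]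
        exact (summable_geometric_of_lt_one (norm_nonneg _) hx).sum_le_tsum _
          fun _ _ ↦ by positivity

lemma norm_pow_mul_prod_one_sub_pow_le (hx : ‖x‖ < 1) (k n : ℕ) :
    ‖x ^ ((k + 1) * n) * ∏ i ∈ Finset.range (n + 1), (1 - x ^ (k + i + 1))‖ ≤
      ‖x‖ ^ n * Real.exp (1 - ‖x‖)⁻¹ := by
  rw [norm_mul, norm_pow]
  gcongr ?_ * ?_
  · exact pow_le_pow_of_le_one (norm_nonneg _) hx.le (Nat.le_mul_of_pos_left _ k.succ_pos)
  · exact norm_prod_one_sub_pow_le hx _ _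

/-- **Pentagonal number theorem** for complex numbers in the open unit disc. -/
lemma tprod_one_sub_pow_eq_tsum_pentagonal (hx : ‖x‖ < 1)
    (hs : Summable fun k : ℕ ↦ (-1) ^ k * (x ^ pentagonal (-k) - x ^ pentagonal (k + 1))) :
    ∏' n : ℕ, (1 - x ^ (n + 1)) =
      ∑' k : ℕ, (-1) ^ k * (x ^ pentagonal (-k) - x ^ pentagonal (k + 1)) := by
  have hgeom : Summable fun n : ℕ ↦ ‖x‖ ^ n * Real.exp (1 - ‖x‖)⁻¹ :=
    (summable_geometric_of_lt_one (norm_nonneg _) hx).mul_right _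
  refine Pentagonal.tprod_one_sub_pow (tendsto_pow_atTop_nhds_zero_of_norm_lt_one hx)
    (fun k ↦ .of_norm_bounded hgeom (norm_pow_mul_prod_one_sub_pow_le hx k)) (fun k ↦ ?_) hs ?_
  · simp_rw [sub_eq_add_neg]
    apply multipliable_one_add_of_summable
    simp_rw [norm_neg, norm_pow, add_assoc]
    exact (summable_nat_add_iff (k + 1)).mpr (summable_geometric_of_lt_one (norm_nonneg _) hx)
  · have hlim : Tendsto (fun k : ℕ ↦ ‖x‖ ^ k * ∑' n : ℕ, ‖x‖ ^ n * Real.exp (1 - ‖x‖)⁻¹)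
        atTop (𝓝 0) := by
      simpa using (tendsto_pow_atTop_nhds_zero_of_lt_one (norm_nonneg _) hx).mul_const _
    refine squeeze_zero_norm (fun k ↦ ?_) hlim
    rw [norm_mul, norm_mul, norm_pow, norm_neg, norm_one, one_pow, one_mul, norm_pow]
    gcongr ?_ * ?_
    · refine pow_le_pow_of_le_one (norm_nonneg _) hx.le ?_
      rw [Nat.le_div_iff_mul_le two_pos]
      nlinarith
    · exact tsum_of_norm_bounded hgeom.hasSum (norm_pow_mul_prod_one_sub_pow_le hx k)

end Pentagonal

section Terms

open Real (pi)

lemma neg_one_zpow_eq_exp (n : ℤ) : (-1 : ℂ) ^ n = exp (pi * I * n) := by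
  rw [← exp_pi_mul_I, ← exp_int_mul]
  ring_nf

lemma neg_one_zpow_mul_exp_mul (a b : ℤ) (u v : ℂ) :
    (-1) ^ a * exp u * ((-1) ^ b * exp v) = (-1) ^ (a + b) * exp (u + v) := by
  rw [mul_mul_mul_comm, ← zpow_add₀ (by norm_num), ← exp_add]

/-- The bilateral term of the series of `θ₁`, written with exponentials. -/
noncomputable def thetaTerm (τ z : ℂ) (m : ℤ) : ℂ :=
  (-1) ^ m * exp (pi * I * τ * (2 * m + 1) ^ 2 / 4 + (2 * m + 1) * (z * I))

/-- One exponential half of the bilateral term of the quintuple product series. -/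
noncomputable def quintupleTerm (τ z : ℂ) (n : ℤ) : ℂ :=
  (-1) ^ n * exp (pi * I * τ * n * (3 * n + 1) + (6 * n + 1) * (z * I))

variable {τ : ℂ} (z : ℂ)

lemma summable_thetaTerm (hτ : 0 < τ.im) : Summable (thetaTerm τ z) := by
  refine (((summable_jacobiTheta₂_term_iff (τ / 2 + z / pi + 1 / 2) τ).mpr hτ).mul_left
    (exp (pi * I * τ / 4 + z * I))).congr fun m ↦ ?_
  rw [thetaTerm, neg_one_zpow_eq_exp, jacobiTheta₂_term, ← exp_add, ← exp_add]
  congr 1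
  field_simp
  ring

lemma summable_quintupleTerm (hτ : 0 < τ.im) : Summable (quintupleTerm τ z) := by
  refine (((summable_jacobiTheta₂_term_iff (τ / 2 + 3 * z / pi + 1 / 2) (3 * τ)).mpr
    (by simpa using hτ)).mul_left (exp (z * I))).congr fun m ↦ ?_
  rw [quintupleTerm, neg_one_zpow_eq_exp, jacobiTheta₂_term, ← exp_add, ← exp_add]
  congr 1
  field_simp
  ring

lemma theta1_eq_tsum_thetaTerm (hτ : 0 < τ.im) :
    theta1 z τ = -I * ∑' m : ℤ, thetaTerm τ z m := by
  rw [theta1, ← (summable_thetaTerm z hτ).hasSum.nat_add_neg_add_one.tsum_eq, ← tsum_mul_left,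
    ← tsum_mul_left]
  congr 1 with n
  have hneg : thetaTerm τ z (-(n + 1)) = -((-1) ^ n *
      (exp (pi * I * τ * (2 * n + 1) ^ 2 / 4) * exp (-((2 * n + 1) * z) * I))) := by
    rw [thetaTerm, ← exp_add, zpow_neg, zpow_add₀ (by norm_num)]
    push_cast
    simp only [zpow_natCast, zpow_one, mul_neg, mul_one, inv_neg, neg_mul, ← inv_pow]
    ring_nf
  have hpos : thetaTerm τ z n = (-1) ^ n *
      (exp (pi * I * τ * (2 * n + 1) ^ 2 / 4) * exp (((2 * n + 1) * z) * I)) := by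
    rw [thetaTerm, ← exp_add, zpow_natCast]
    push_cast
    ring_nf
  rw [hneg, hpos, Complex.sin]
  ring

lemma two_mul_tsum_cos_eq (hτ : 0 < τ.im) :
    2 * ∑' n : ℤ, (-1 : ℂ) ^ n * exp (pi * I * τ * n * (3 * n + 1)) * cos ((6 * n + 1) * z) =
      ∑' n : ℤ, quintupleTerm τ z n + ∑' n : ℤ, quintupleTerm τ (-z) n := by
  rw [← (summable_quintupleTerm z hτ).tsum_add (summable_quintupleTerm (-z) hτ), ← tsum_mul_left]
  congr 1 with n
  rw [quintupleTerm, quintupleTerm, Complex.cos, exp_add, exp_add]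
  ring_nf

lemma hasSum_quintupleTerm_zero (hτ : 0 < τ.im) :
    HasSum (quintupleTerm τ 0) (∏' n : ℕ, (1 - exp (2 * pi * I * τ) ^ (n + 1))) := by
  have hq : ‖exp (2 * pi * I * τ)‖ < 1 := by
    rw [norm_exp, Real.exp_lt_one_iff]
    simp [hτ, Real.pi_pos]
  have hs := summable_quintupleTerm 0 hτ
  have hnat := hs.hasSum.nat_add_neg_add_one
  have hterm (k : ℕ) : quintupleTerm τ 0 k + quintupleTerm τ 0 (-(k + 1)) = (-1) ^ k *
      (exp (2 * pi * I * τ) ^ pentagonal (-k) - exp (2 * pi * I * τ) ^ pentagonal (k + 1)) := by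
    have hk : 2 * (pentagonal (-k) : ℂ) = k * (3 * k + 1) :=
      mod_cast two_mul_natCast_pentagonal_neg k
    have hk' : 2 * (pentagonal (k + 1) : ℂ) = (k + 1) * (3 * (k + 1) - 1) :=
      mod_cast congrArg (Int.cast (R := ℂ)) (two_mul_natCast_pentagonal (k + 1))
    rw [← exp_nat_mul, ← exp_nat_mul,
      show (pentagonal (-k) : ℂ) * (2 * pi * I * τ) = pi * I * τ * (k * (3 * k + 1)) by
        rw [← hk]; ring,
      show (pentagonal (k + 1) : ℂ) * (2 * pi * I * τ) =
        pi * I * τ * ((k + 1) * (3 * (k + 1) - 1)) by rw [← hk']; ring,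
      quintupleTerm, quintupleTerm, zpow_neg, zpow_add₀ (by norm_num)]
    push_cast
    simp only [zpow_natCast, zpow_one, mul_neg, mul_one, inv_neg, neg_mul, ← inv_pow]
    ring_nf
  simp_rw [hterm] at hnat
  rw [tprod_one_sub_pow_eq_tsum_pentagonal hq hnat.summable, hnat.tsum_eq]
  exact hs.hasSum

lemma thetaTerm_mul_quintupleTerm_neg (τ : ℂ) (j n : ℤ) :
    thetaTerm τ z (2 * j + 3 * (n - j)) * quintupleTerm τ (-z) (n - j) =
      -(thetaTerm τ z (2 * j - 1 - 3 * n) * quintupleTerm τ z n) := by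
  simp only [thetaTerm, quintupleTerm]
  rw [neg_one_zpow_mul_exp_mul, neg_one_zpow_mul_exp_mul, Even.neg_one_zpow ⟨2 * n - j, by ring⟩,
    Odd.neg_one_zpow ⟨j - n - 1, by ring⟩, neg_one_mul, neg_neg, one_mul]
  congr 1
  push_cast
  ring

lemma thetaTerm_mul_quintupleTerm (τ : ℂ) (j n : ℤ) :
    thetaTerm τ z (2 * j + 1 - 1 - 3 * n) * quintupleTerm τ z n =
      thetaTerm τ (2 * z) j * quintupleTerm τ 0 (j - 2 * n) := by
  simp only [thetaTerm, quintupleTerm]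
  rw [neg_one_zpow_mul_exp_mul, neg_one_zpow_mul_exp_mul, Even.neg_one_zpow ⟨j - n, by ring⟩,
    Even.neg_one_zpow ⟨j - n, by ring⟩]
  congr 2
  push_cast
  ring

lemma thetaTerm_mul_quintupleTerm_neg' (τ : ℂ) (j n : ℤ) :
    thetaTerm τ z (2 * j + 1 + 3 * n) * quintupleTerm τ (-z) n =
      thetaTerm τ (2 * z) j * quintupleTerm τ 0 (j - (2 * (n + j) + 1)) := by
  simp only [thetaTerm, quintupleTerm]
  rw [neg_one_zpow_mul_exp_mul, neg_one_zpow_mul_exp_mul, Odd.neg_one_zpow ⟨j + 2 * n, by ring⟩,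
    Odd.neg_one_zpow ⟨-n - 1, by ring⟩]
  congr 2
  push_cast
  ring

/-- The cleared-denominator form of the quintuple product identity. -/
lemma tsum_thetaTerm_mul_tsum_quintupleTerm (hτ : 0 < τ.im) :
    (∑' m : ℤ, thetaTerm τ z m) *
        (∑' n : ℤ, quintupleTerm τ z n + ∑' n : ℤ, quintupleTerm τ (-z) n) =
      (∑' m : ℤ, thetaTerm τ (2 * z) m) * ∑' n : ℤ, quintupleTerm τ 0 n := by
  have hθ := summable_thetaTerm z hτ
  have hprod (w : ℂ) : HasSum (fun p : ℤ × ℤ ↦ thetaTerm τ z p.1 * quintupleTerm τ w p.2)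
      ((∑' m : ℤ, thetaTerm τ z m) * ∑' n : ℤ, quintupleTerm τ w n) :=
    hθ.hasSum.mul (summable_quintupleTerm w hτ).hasSum
      (summable_mul_of_summable_norm hθ.norm (summable_quintupleTerm w hτ).norm)
  let shear (c : ℤ → ℤ) : ℤ × ℤ ≃ ℤ × ℤ :=
    { toFun := fun p ↦ (p.1 + c p.2, p.2)
      invFun := fun p ↦ (p.1 - c p.2, p.2)
      left_inv := fun p ↦ by simp
      right_inv := fun p ↦ by simp }
  have hplus : HasSum (fun p : ℤ × ℤ ↦ thetaTerm τ z (p.1 - 1 - 3 * p.2) * quintupleTerm τ z p.2)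
      ((∑' m : ℤ, thetaTerm τ z m) * ∑' n : ℤ, quintupleTerm τ z n) := by
    convert (shear fun n ↦ -1 - 3 * n).hasSum_iff.mpr (hprod z) using 2 with p
    simp only [Function.comp_apply, shear, Equiv.coe_fn_mk]
    ring_nf
  have hminus : HasSum (fun p : ℤ × ℤ ↦ thetaTerm τ z (p.1 + 3 * p.2) * quintupleTerm τ (-z) p.2)
      ((∑' m : ℤ, thetaTerm τ z m) * ∑' n : ℤ, quintupleTerm τ (-z) n) :=
    (shear fun n ↦ 3 * n).hasSum_iff.mpr (hprod (-z))
  have hfib (l : ℤ) := (hplus.summable.prod_factor l).hasSum.add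
    (hminus.summable.prod_factor l).hasSum
  have htotal := (hplus.add hminus).prod_fiberwise hfib
  rw [← mul_add] at htotal
  have heven (j : ℤ) : ∑' n : ℤ, thetaTerm τ z (2 * j - 1 - 3 * n) * quintupleTerm τ z n +
      ∑' n : ℤ, thetaTerm τ z (2 * j + 3 * n) * quintupleTerm τ (-z) n = 0 := by
    have hshift := (Equiv.subRight j).tsum_eq fun n ↦
      thetaTerm τ z (2 * j + 3 * n) * quintupleTerm τ (-z) n
    simp only [Equiv.subRight_apply, thetaTerm_mul_quintupleTerm_neg, tsum_neg] at hshift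
    rw [← hshift, add_neg_cancel]
  have hodd (j : ℤ) : ∑' n : ℤ, thetaTerm τ z (2 * j + 1 - 1 - 3 * n) * quintupleTerm τ z n +
      ∑' n : ℤ, thetaTerm τ z (2 * j + 1 + 3 * n) * quintupleTerm τ (-z) n =
      thetaTerm τ (2 * z) j * ∑' n : ℤ, quintupleTerm τ 0 n := by
    simp only [thetaTerm_mul_quintupleTerm, thetaTerm_mul_quintupleTerm_neg', tsum_mul_left]
    have hs : Summable fun n ↦ quintupleTerm τ 0 (j - n) :=
      (summable_quintupleTerm 0 hτ).comp_injective (i := fun n ↦ j - n) sub_right_injective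
    have he : Summable fun n ↦ quintupleTerm τ 0 (j - 2 * n) :=
      hs.comp_injective (i := fun n ↦ 2 * n) fun x y h ↦ by simpa using h
    have ho : Summable fun n ↦ quintupleTerm τ 0 (j - (2 * n + 1)) :=
      hs.comp_injective (i := fun n ↦ 2 * n + 1) fun x y h ↦ by simpa using h
    have hshift := (Equiv.addRight j).tsum_eq fun n ↦ quintupleTerm τ 0 (j - (2 * n + 1))
    have hflip := (Equiv.subLeft j).tsum_eq (quintupleTerm τ 0)
    simp only [Equiv.coe_addRight, Equiv.subLeft_apply] at hshift hflip
    rw [← mul_add, hshift, ← hflip,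
      (HasSum.int_even_add_odd (f := fun n ↦ quintupleTerm τ 0 (j - n))
        he.hasSum ho.hasSum).tsum_eq]
  refine htotal.unique ?_
  rw [← zero_add (_ * _)]
  refine HasSum.int_even_add_odd ?_ ?_
  · simp only [heven]
    exact hasSum_zero
  · simp only [hodd]
    exact (summable_thetaTerm (2 * z) hτ).hasSum.mul_right _

end Terms

theorem kiepert_quintuple_product (τ : ℂ) (hτ : 0 < τ.im)
    (q : ℂ) (hq : q = Complex.exp (2 * Real.pi * Complex.I * τ))
    (z : ℂ) (hz : theta1 z τ ≠ 0) :
    2 * ∑' n : ℤ, (-1 : ℂ) ^ n *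
        Complex.exp (Real.pi * Complex.I * τ * n * (3 * n + 1)) *
        Complex.cos ((6 * n + 1) * z) =
      (∏' n : ℕ, (1 - q ^ (n + 1))) * theta1 (2 * z) τ / theta1 z τ := by
  rw [eq_div_iff hz, two_mul_tsum_cos_eq z hτ, hq, ← (hasSum_quintupleTerm_zero hτ).tsum_eq,
    theta1_eq_tsum_thetaTerm z hτ, theta1_eq_tsum_thetaTerm (2 * z) hτ]
  linear_combination -I * tsum_thetaTerm_mul_tsum_quintupleTerm z hτ
end
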